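/- Let G be a finite connected simple graph with nonnegative edge weights, let F be a set of triangles of G, let B ⊆ Z(G) be the ℤ/2-span of the boundary edge sets of the triangles of F, and let g = dim(Z(G)/B). Suppose that for every vertex s of G a shortest-path tree T_s rooted at s exists, and let Π be the set of all fundamental cycles γ(T_s, e) over all vertices s and all edges e ∈ E(G) \ E(T_s). List the cycles of Π in nondecreasing order of weight and greedily select a cycle whenever its coset modulo B does not lie in the span of the cosets of the previously selected cycles. Then exactly g cycles are selected, their cosets form a basis of Z(G)/B, and their total weight is minimum among all families of g elements of Z(G) whose cosets form a basis of Z(G)/B. -/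

import Mathlib

/-- The cycle space of a finite simple graph over `ℤ/2`: edge sets (indicator functions
on `Sym2 V`) supported on edges of `G` in which every vertex is incident to an even
number of edges of the set. -/
def cycleSpace {V : Type*} [Fintype V] [DecidableEq V] (G : SimpleGraph V)
    [DecidableRel G.Adj] : Submodule (ZMod 2) (Sym2 V → ZMod 2) :=
  (⨅ (e : Sym2 V) (_ : e ∉ G.edgeSet),
      LinearMap.ker (LinearMap.proj (R := ZMod 2) (φ := fun _ : Sym2 V => ZMod 2) e)) ⊓
  ⨅ (v : V),
      LinearMap.ker (∑ e ∈ G.edgeFinset.filter (fun e => v ∈ e),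
        LinearMap.proj (R := ZMod 2) (φ := fun _ : Sym2 V => ZMod 2) e)

/-- The weight of an edge set (an indicator function on `Sym2 V`): the sum of the
weights of the edges it contains. -/
def edgeWeight {V : Type*} [Fintype V] [DecidableEq V] (w : Sym2 V → ℝ)
    (z : Sym2 V → ZMod 2) : ℝ :=
  ∑ e ∈ Finset.univ.filter (fun e => z e = 1), w e

/-- Greedy selection with respect to a subspace `B`: scan the input list from left to
right, keeping an element exactly when its coset modulo `B` does not lie in the span of
the cosets of the previously kept elements (`acc` is the accumulator of kept elements). -/
noncomputable def greedySelect {M : Type*} [AddCommGroup M] [Module (ZMod 2) M]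
    (B : Submodule (ZMod 2) M) : List M → List M → List M
  | acc, [] => acc
  | acc, c :: L =>
    letI := Classical.propDecidable
      (B.mkQ c ∈ Submodule.span (ZMod 2) (B.mkQ '' {x | x ∈ acc}))
    if B.mkQ c ∈ Submodule.span (ZMod 2) (B.mkQ '' {x | x ∈ acc})
    then greedySelect B acc L
    else greedySelect B (acc ++ [c]) L

section Greedy

variable {M : Type*} [AddCommGroup M] [Module (ZMod 2) M] {B : Submodule (ZMod 2) M}

theorem greedySelect_cons_of_mem {acc L : List M} {c : M}
    (h : B.mkQ c ∈ Submodule.span (ZMod 2) (B.mkQ '' {x | x ∈ acc})) :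
    greedySelect B acc (c :: L) = greedySelect B acc L := by
  rw [greedySelect]; exact if_pos h

theorem greedySelect_cons_of_notMem {acc L : List M} {c : M}
    (h : B.mkQ c ∉ Submodule.span (ZMod 2) (B.mkQ '' {x | x ∈ acc})) :
    greedySelect B acc (c :: L) = greedySelect B (acc ++ [c]) L := by
  rw [greedySelect]; exact if_neg h

theorem mem_greedySelect_of_mem_acc {acc L : List M} {x : M} (hx : x ∈ acc) :
    x ∈ greedySelect B acc L := by
  induction L generalizing acc with
  | nil => simpa [greedySelect] using hx
  | cons c L ih =>
    by_cases h : B.mkQ c ∈ Submodule.span (ZMod 2) (B.mkQ '' {x | x ∈ acc})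
    · rw [greedySelect_cons_of_mem h]; exact ih hx
    · rw [greedySelect_cons_of_notMem h]; exact ih (List.mem_append_left _ hx)

theorem greedySelect_sublist (acc L : List M) :
    (greedySelect B acc L).Sublist (acc ++ L) := by
  induction L generalizing acc with
  | nil => simp [greedySelect]
  | cons c L ih =>
    by_cases h : B.mkQ c ∈ Submodule.span (ZMod 2) (B.mkQ '' {x | x ∈ acc})
    · rw [greedySelect_cons_of_mem h]
      exact (ih acc).trans ((List.sublist_cons_self c L).append_left acc)
    · rw [greedySelect_cons_of_notMem h]
      simpa using ih (acc ++ [c])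

theorem linearIndepOn_greedySelect {acc : List M} (L : List M)
    (hacc : LinearIndepOn (ZMod 2) B.mkQ {x | x ∈ acc}) :
    LinearIndepOn (ZMod 2) B.mkQ {x | x ∈ greedySelect B acc L} := by
  induction L generalizing acc with
  | nil => simpa [greedySelect] using hacc
  | cons c L ih =>
    by_cases h : B.mkQ c ∈ Submodule.span (ZMod 2) (B.mkQ '' {x | x ∈ acc})
    · rw [greedySelect_cons_of_mem h]; exact ih hacc
    · rw [greedySelect_cons_of_notMem h]
      refine ih ?_
      have : {x | x ∈ acc ++ [c]} = insert c {x | x ∈ acc} := by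
        ext x; simp [or_comm]
      rw [this]
      exact hacc.insert h

/-- If the input is sorted by weight, every input element is spanned, modulo `B`, by the
selected elements of at most its weight. -/
theorem mkQ_mem_span_greedySelect {ω : M → ℝ} {acc L : List M}
    (hs : (acc ++ L).Pairwise (fun c c' => ω c ≤ ω c')) {c : M} (hc : c ∈ acc ++ L) :
    B.mkQ c ∈ Submodule.span (ZMod 2)
      (B.mkQ '' {a | a ∈ greedySelect B acc L ∧ ω a ≤ ω c}) := by
  induction L generalizing acc with
  | nil => exact Submodule.subset_span ⟨c, ⟨by simpa [greedySelect] using hc, le_rfl⟩, rfl⟩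
  | cons d L ih =>
    by_cases h : B.mkQ d ∈ Submodule.span (ZMod 2) (B.mkQ '' {x | x ∈ acc})
    · rw [greedySelect_cons_of_mem h]
      by_cases hcd : c = d
      · subst hcd
        have hsub : {x | x ∈ acc} ⊆ {a | a ∈ greedySelect B acc L ∧ ω a ≤ ω c} := fun x hx =>
          ⟨mem_greedySelect_of_mem_acc hx, (List.pairwise_append.1 hs).2.2 x hx c (by simp)⟩
        exact Submodule.span_mono (Set.image_mono hsub) h
      · refine ih (hs.sublist ((List.sublist_cons_self d L).append_left acc)) ?_
        simpa [hcd] using hc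
    · rw [greedySelect_cons_of_notMem h]
      exact ih (by simpa using hs) (by simpa using hc)

theorem sum_map_le_sum_of_linearIndependent_mkQ {ω : M → ℝ} {A : List M}
    (hA : A.Pairwise (fun c c' => ω c ≤ ω c')) {g : ℕ} (hg : A.length = g) (H : Fin g → M)
    (hH : LinearIndependent (ZMod 2) (fun i => B.mkQ (H i)))
    (hspan : ∀ i, B.mkQ (H i) ∈ Submodule.span (ZMod 2)
      (B.mkQ '' {a | a ∈ A ∧ ω a ≤ ω (H i)})) :
    (A.map ω).sum ≤ ∑ i, ω (H i) := by
  subst hg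
  let σ := Tuple.sort (ω ∘ H)
  have hσ : Monotone ((ω ∘ H) ∘ σ) := Tuple.monotone_sort _
  rw [← Fin.sum_univ_fun_getElem, ← Equiv.sum_comp σ (fun i => ω (H i))]
  refine Finset.sum_le_sum fun i _ => ?_
  by_contra! hlt
  let b : Fin i → M ⧸ B := fun j => B.mkQ A[j]
  let h : Fin (i + 1) → M ⧸ B := fun j => B.mkQ (H (σ (Fin.castLE i.2 j)))
  have hh : LinearIndependent (ZMod 2) h :=
    hH.comp (fun j => σ (Fin.castLE i.2 j)) (σ.injective.comp (Fin.castLE_injective _))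
  have hle : Submodule.span (ZMod 2) (Set.range h) ≤ Submodule.span (ZMod 2) (Set.range b) := by
    rw [Submodule.span_le]
    rintro _ ⟨j, rfl⟩
    refine Submodule.span_mono ?_ (hspan (σ (Fin.castLE i.2 j)))
    rintro _ ⟨a, ⟨ha, haw⟩, rfl⟩
    obtain ⟨k, hk, rfl⟩ := List.getElem_of_mem ha
    have hji : ω (H (σ (Fin.castLE i.2 j))) ≤ ω (H (σ i)) :=
      hσ (Fin.le_def.2 (Nat.lt_succ_iff.1 j.2))
    have hki : k < i := by
      by_contra! hik
      rcases hik.eq_or_lt with hik | hik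
      · subst hik
        exact absurd (haw.trans hji) (not_le.2 hlt)
      · have := List.pairwise_iff_getElem.1 hA i k i.2 hk hik
        exact absurd (haw.trans hji) (not_le.2 (hlt.trans_le this))
    exact ⟨⟨k, hki⟩, rfl⟩
  have h1 := finrank_span_eq_card hh
  have h2 := finrank_range_le_card (R := ZMod 2) b
  have := FiniteDimensional.span_of_finite (ZMod 2) (Set.finite_range b)
  have h3 := Submodule.finrank_mono hle
  rw [Set.finrank] at h2
  simp only [Fintype.card_fin] at h1 h2
  omega

end Greedy

section EdgeSum

variable {V : Type*} [DecidableEq V]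

/-- The mod-2 edge set of a list of edges: the edges occurring an odd number of times. -/
def edgeSum (l : List (Sym2 V)) : Sym2 V → ZMod 2 :=
  (l.map fun e => Pi.single e 1).sum

@[simp] theorem edgeSum_nil : edgeSum ([] : List (Sym2 V)) = 0 := rfl

@[simp] theorem edgeSum_cons (e : Sym2 V) (l : List (Sym2 V)) :
    edgeSum (e :: l) = Pi.single e 1 + edgeSum l := by
  simp [edgeSum]

theorem edgeSum_append (l l' : List (Sym2 V)) :
    edgeSum (l ++ l') = edgeSum l + edgeSum l' := by
  simp [edgeSum]

theorem edgeSum_reverse (l : List (Sym2 V)) : edgeSum l.reverse = edgeSum l := by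
  simp [edgeSum, List.sum_reverse]

theorem edgeSum_of_nodup {l : List (Sym2 V)} (hl : l.Nodup) :
    edgeSum l = fun f => if f ∈ l then 1 else 0 := by
  induction l with
  | nil => ext; simp
  | cons e l ih =>
    rw [List.nodup_cons] at hl
    rw [edgeSum_cons, ih hl.2]
    ext f
    by_cases hf : f = e
    · subst hf; simp [hl.1]
    · simp [hf]

theorem edgeSum_edges_eq_of_isAcyclic {T : SimpleGraph V} (hT : T.IsAcyclic) {u v : V}
    (q p : T.Walk u v) (hp : p.IsPath) : edgeSum q.edges = edgeSum p.edges := by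
  have path_eq {a b : V} (p₁ p₂ : T.Walk a b) (h₁ : p₁.IsPath) (h₂ : p₂.IsPath) : p₁ = p₂ :=
    congrArg Subtype.val ((hT.subsingleton_path a b).elim ⟨p₁, h₁⟩ ⟨p₂, h₂⟩)
  induction q with
  | nil =>
    rw [path_eq .nil p .nil hp]
  | @cons u x v h q ih =>
    rw [SimpleGraph.Walk.edges_cons, edgeSum_cons, ih q.bypass q.bypass_isPath]
    by_cases hu : u ∈ q.bypass.support
    · have h1 := path_eq _ p (q.bypass_isPath.dropUntil hu) hp
      have h2 := path_eq _ (.cons h.symm .nil) (q.bypass_isPath.takeUntil hu)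
        (by simp [h.ne'])
      rw [← q.bypass.take_spec hu, h1, h2]
      simp only [SimpleGraph.Walk.cons_append, SimpleGraph.Walk.nil_append,
        SimpleGraph.Walk.edges_cons, edgeSum_cons, Sym2.eq_swap (a := x)]
      rw [← add_assoc, ZModModule.add_self, zero_add]
    · rw [← path_eq (.cons h q.bypass) p ((SimpleGraph.Walk.cons_isPath_iff _ _).2
        ⟨q.bypass_isPath, hu⟩) hp]
      simp

variable {G : SimpleGraph V}

theorem edgeSum_edges_apply_of_notMem {u v : V} (p : G.Walk u v) {e : Sym2 V}
    (he : e ∉ G.edgeSet) : edgeSum p.edges e = 0 := by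
  induction p with
  | nil => simp
  | cons h p ih =>
    have : e ≠ s(_, _) := fun h' => he (h' ▸ G.mem_edgeSet.2 h)
    simp [ih, Pi.single_eq_of_ne this]

/-- Telescoping along a closed walk: if every step `uv` satisfies `P u + uv + P v ∈ S` as soon as
it lies on a closed walk through `a` of weight at most `W`, then so does the whole walk. -/
theorem add_edgeSum_edges_add_mem {w : Sym2 V → ℝ} {W : ℝ} {a : V}
    {S : Submodule (ZMod 2) (Sym2 V → ZMod 2)} {P : V → Sym2 V → ZMod 2}
    (hP : ∀ ⦃u v : V⦄, G.Adj u v → ∀ (r : G.Walk a u) (q : G.Walk v a),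
      (r.edges.map w).sum + w s(u, v) + (q.edges.map w).sum ≤ W →
        P u + Pi.single s(u, v) 1 + P v ∈ S)
    {u : V} (r : G.Walk a u) (q : G.Walk u a)
    (hrq : (r.edges.map w).sum + (q.edges.map w).sum ≤ W) :
    P u + edgeSum q.edges + P a ∈ S := by
  induction q with
  | nil => simp [ZModModule.add_self]
  | @cons u v a h q ih =>
    rw [SimpleGraph.Walk.edges_cons, List.map_cons, List.sum_cons, ← add_assoc] at hrq
    have h1 := hP h r q hrq
    have h2 := ih hP (r.concat h) (by simpa [SimpleGraph.Walk.edges_concat, add_assoc] using hrq)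
    convert S.add_mem h1 h2 using 1
    have hvv := ZModModule.add_self (P v)
    rw [SimpleGraph.Walk.edges_cons, edgeSum_cons]
    calc _ = P u + (Pi.single s(u, v) 1 + edgeSum q.edges) + P a + (P v + P v) := by
          rw [hvv, add_zero]
      _ = _ := by abel

variable [Fintype V]

theorem edgeWeight_add_le {w : Sym2 V → ℝ} (hw : ∀ e, 0 ≤ w e) (y z : Sym2 V → ZMod 2) :
    edgeWeight w (y + z) ≤ edgeWeight w y + edgeWeight w z := by
  simp only [edgeWeight, Finset.sum_filter, ← Finset.sum_add_distrib]
  refine Finset.sum_le_sum fun e _ => ?_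
  have hor : (y + z) e = 1 → y e = 1 ∨ z e = 1 := by
    rw [Pi.add_apply]; generalize y e = a; generalize z e = b; revert a b; decide
  have := hw e
  split_ifs <;> first | linarith | (exfalso; tauto)

theorem edgeWeight_edgeSum_le {w : Sym2 V → ℝ} (hw : ∀ e, 0 ≤ w e) (l : List (Sym2 V)) :
    edgeWeight w (edgeSum l) ≤ (l.map w).sum := by
  induction l with
  | nil => simp [edgeWeight]
  | cons e l ih =>
    rw [edgeSum_cons, List.map_cons, List.sum_cons]
    refine (edgeWeight_add_le hw _ _).trans (add_le_add (le_of_eq ?_) ih)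
    simp [edgeWeight, Pi.single_apply, Finset.sum_filter]

/-- If a subspace contains every fundamental cycle of weight at most `W` of a shortest-path tree
rooted at `a`, then it contains every closed walk through `a` of weight at most `W`. -/
theorem edgeSum_edges_mem_of_shortestPathTree {w : Sym2 V → ℝ} (hw : ∀ e, 0 ≤ w e) {W : ℝ}
    {T : SimpleGraph V} (hT : T.IsTree) {a : V}
    (hshort : ∀ u, ∀ p : T.Walk a u, p.IsPath →
      ∀ q : G.Walk a u, (p.edges.map w).sum ≤ (q.edges.map w).sum)
    {S : Submodule (ZMod 2) (Sym2 V → ZMod 2)}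
    (hS : ∀ ⦃u v : V⦄, G.Adj u v → ¬ T.Adj u v → ∀ p : T.Walk u v, p.IsPath →
      edgeWeight w (edgeSum (s(u, v) :: p.edges)) ≤ W → edgeSum (s(u, v) :: p.edges) ∈ S)
    (c : G.Walk a a) (hc : (c.edges.map w).sum ≤ W) : edgeSum c.edges ∈ S := by
  choose r hr _ using hT.existsUnique_path a
  have hra : r a = .nil :=
    (hT.existsUnique_path a a).unique (hr a) SimpleGraph.Walk.IsPath.nil
  have key := add_edgeSum_edges_add_mem (G := G) (w := w) (W := W) (S := S)
    (P := fun u => edgeSum (r u).edges) (a := a) ?_ .nil c (by simpa using hc)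
  · simpa [hra] using key
  intro u v huv q q' hW
  by_cases hTuv : T.Adj u v
  · have h := edgeSum_edges_eq_of_isAcyclic hT.isAcyclic ((r u).concat hTuv) (r v) (hr v)
    rw [SimpleGraph.Walk.edges_concat, List.concat_eq_append, edgeSum_append, edgeSum_cons,
      edgeSum_nil, add_zero] at h
    rw [h, ZModModule.add_self]
    exact S.zero_mem
  · obtain ⟨p, hp, -⟩ := hT.existsUnique_path u v
    have h := edgeSum_edges_eq_of_isAcyclic hT.isAcyclic ((r u).reverse.append (r v)) p hp
    rw [SimpleGraph.Walk.edges_append, SimpleGraph.Walk.edges_reverse, edgeSum_append,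
      edgeSum_reverse] at h
    have heq : edgeSum (r u).edges + Pi.single s(u, v) 1 + edgeSum (r v).edges =
        edgeSum (s(u, v) :: p.edges) := by
      rw [edgeSum_cons, ← h]; abel
    rw [heq]
    refine hS huv hTuv p hp ?_
    have hfund : edgeSum (s(u, v) :: p.edges) =
        edgeSum ((r u).edges ++ s(u, v) :: (r v).edges) := by
      rw [← heq, edgeSum_append, edgeSum_cons, add_assoc]
    rw [hfund]
    refine (edgeWeight_edgeSum_le hw _).trans ?_
    have h1 := hshort u (r u) (hr u) q
    have h2 := hshort v (r v) (hr v) q'.reverse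
    rw [SimpleGraph.Walk.edges_reverse, List.map_reverse, List.sum_reverse] at h2
    simp only [List.map_append, List.map_cons, List.sum_append, List.sum_cons]
    linarith

variable [DecidableRel G.Adj]

theorem mem_cycleSpace_iff {z : Sym2 V → ZMod 2} :
    z ∈ cycleSpace G ↔ (∀ e ∉ G.edgeSet, z e = 0) ∧
      ∀ v, ∑ e ∈ G.edgeFinset.filter (fun e => v ∈ e), z e = 0 := by
  simp [cycleSpace, Submodule.mem_inf, Submodule.mem_iInf, LinearMap.sum_apply]

theorem sum_incident_edgeSum_edges {u v : V} (p : G.Walk u v) (x : V) :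
    ∑ e ∈ G.edgeFinset.filter (fun e => x ∈ e), edgeSum p.edges e =
      (if x = u then 1 else 0) + (if x = v then 1 else 0) := by
  induction p with
  | nil => simp [CharTwo.add_self_eq_zero]
  | @cons u y v h p ih =>
    have key : ∑ e ∈ G.edgeFinset.filter (fun e => x ∈ e),
        (Pi.single s(u, y) 1 : Sym2 V → ZMod 2) e =
        (if x = u then 1 else 0) + (if x = y then 1 else 0) := by
      have hne := h.ne
      simp only [Pi.single_apply, Finset.sum_ite_eq']
      simp only [Finset.mem_filter, SimpleGraph.mem_edgeFinset, SimpleGraph.mem_edgeSet, h,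
        true_and, Sym2.mem_iff]
      by_cases h1 : x = u <;> by_cases h2 : x = y <;> simp_all
    simp only [SimpleGraph.Walk.edges_cons, edgeSum_cons, Pi.add_apply, Finset.sum_add_distrib,
      key, ih]
    generalize (if x = y then (1 : ZMod 2) else 0) = b
    rw [add_assoc, ← add_assoc b, CharTwo.add_self_eq_zero, zero_add]

theorem edgeSum_edges_mem_cycleSpace {u : V} (p : G.Walk u u) :
    edgeSum p.edges ∈ cycleSpace G :=
  mem_cycleSpace_iff.2 ⟨fun _ he => edgeSum_edges_apply_of_notMem p he, fun x => by
    rw [sum_incident_edgeSum_edges, CharTwo.add_self_eq_zero]⟩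

theorem sum_mul_sum_mem_eq_zero {z : Sym2 V → ZMod 2} (hz : z ∈ cycleSpace G)
    (χ : V → ZMod 2) :
    ∑ e ∈ G.edgeFinset, z e * ∑ x with x ∈ e, χ x = 0 := by
  have h : ∑ x, χ x * ∑ e ∈ G.edgeFinset.filter (fun e => x ∈ e), z e = 0 :=
    Finset.sum_eq_zero fun x _ => by rw [(mem_cycleSpace_iff.1 hz).2 x, mul_zero]
  simp only [Finset.sum_filter, Finset.mul_sum] at h ⊢
  rw [Finset.sum_comm]
  refine Eq.trans ?_ h
  refine Finset.sum_congr rfl fun x _ => Finset.sum_congr rfl fun e _ => ?_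
  split_ifs <;> simp [mul_comm]

theorem exists_cycle_of_mem_cycleSpace {z : Sym2 V → ZMod 2} (hz : z ∈ cycleSpace G)
    (h0 : z ≠ 0) :
    ∃ (a : V) (c : G.Walk a a), c.IsCycle ∧ ∀ e ∈ c.edges, z e = 1 := by
  obtain ⟨e, he⟩ := Function.ne_iff.1 h0
  have hedge : ∀ e, z e ≠ 0 → e ∈ G.edgeSet := fun e he => by
    by_contra h; exact he ((mem_cycleSpace_iff.1 hz).1 e h)
  let S : SimpleGraph V := SimpleGraph.fromEdgeSet {e | z e ≠ 0}
  have hSG : S ≤ G := fun x y h =>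
    G.mem_edgeSet.1 (hedge _ ((SimpleGraph.fromEdgeSet_adj _).1 h).1)
  induction e with | _ u v
  have huv : G.Adj u v := hedge _ he
  have hS : S.Adj u v := (SimpleGraph.fromEdgeSet_adj _).2 ⟨he, huv.ne⟩
  have hreach : (S.deleteEdges {s(u, v)}).Reachable u v := by
    by_contra hn
    classical
    let χ : V → ZMod 2 := fun x => if (S.deleteEdges {s(u, v)}).Reachable u x then 1 else 0
    have pair {x y : V} (hxy : x ≠ y) : ∑ t with t ∈ s(x, y), χ t = χ x + χ y := by
      rw [← Finset.sum_pair hxy]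
      refine Finset.sum_congr ?_ fun _ _ => rfl
      ext; simp
    have h := sum_mul_sum_mem_eq_zero hz χ
    rw [Finset.sum_eq_single_of_mem s(u, v) (SimpleGraph.mem_edgeFinset.2 huv), pair huv.ne] at h
    · have h1 : χ u = 1 := if_pos (SimpleGraph.Reachable.refl u)
      have h2 : χ v = 0 := if_neg hn
      rw [h1, h2] at h
      exact he (by simpa using h)
    · intro f hf hfe
      induction f with | _ x y
      have hxy : G.Adj x y := SimpleGraph.mem_edgeFinset.1 hf
      by_cases hzf : z s(x, y) = 0
      · rw [hzf, zero_mul]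
      have hadj : (S.deleteEdges {s(u, v)}).Adj x y := by
        rw [SimpleGraph.deleteEdges_adj]
        exact ⟨(SimpleGraph.fromEdgeSet_adj _).2 ⟨hzf, hxy.ne⟩, hfe⟩
      have : χ x = χ y := by
        simp only [χ, show (S.deleteEdges {s(u, v)}).Reachable u x ↔
          (S.deleteEdges {s(u, v)}).Reachable u y from
          ⟨fun h => h.trans hadj.reachable, fun h => h.trans hadj.symm.reachable⟩]
      rw [pair hxy.ne, this, CharTwo.add_self_eq_zero, mul_zero]
  obtain ⟨a, c, hc, -⟩ :=
    SimpleGraph.adj_and_reachable_delete_edges_iff_exists_cycle.1 ⟨hS, hreach⟩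
  refine ⟨a, c.mapLe hSG, hc.mapLe hSG, fun e he => ?_⟩
  rw [SimpleGraph.Walk.edges_mapLe_eq_edges] at he
  have h1 := c.edges_subset_edgeSet he
  rw [SimpleGraph.edgeSet_fromEdgeSet] at h1
  have h2 : z e ≠ 0 := h1.1
  revert h2; generalize z e = b; revert b; decide

/-- A subspace containing every cycle of weight at most `W` contains every cycle-space element
of weight at most `W`. -/
theorem mem_of_edgeWeight_le {w : Sym2 V → ℝ} (hw : ∀ e, 0 ≤ w e) {W : ℝ}
    {S : Submodule (ZMod 2) (Sym2 V → ZMod 2)}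
    (hS : ∀ (a : V) (c : G.Walk a a), (c.edges.map w).sum ≤ W → edgeSum c.edges ∈ S)
    {z : Sym2 V → ZMod 2} (hz : z ∈ cycleSpace G) (hzW : edgeWeight w z ≤ W) : z ∈ S := by
  induction hn : (Finset.univ.filter fun e => z e = 1).card using Nat.strong_induction_on
    generalizing z with
  | _ n ih =>
  by_cases h0 : z = 0
  · rw [h0]; exact S.zero_mem
  obtain ⟨a, c, hc, hcz⟩ := exists_cycle_of_mem_cycleSpace hz h0
  have hnd : c.edges.Nodup := hc.edges_nodup
  have hcW : (c.edges.map w).sum ≤ edgeWeight w z := by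
    rw [← List.sum_toFinset w hnd, edgeWeight]
    exact Finset.sum_le_sum_of_subset_of_nonneg
      (fun e he => by simpa using hcz e (by simpa using he))
      fun e _ _ => hw e
  have hsub : (Finset.univ.filter fun e => (z + edgeSum c.edges) e = 1) ⊆
      Finset.univ.filter fun e => z e = 1 := by
    intro e he
    by_contra hze
    simp only [Finset.mem_filter, Finset.mem_univ, true_and] at he hze
    have : e ∉ c.edges := fun h => hze (hcz e h)
    simp [edgeSum_of_nodup hnd, this] at he
    exact hze he
  have hssub : (Finset.univ.filter fun e => (z + edgeSum c.edges) e = 1) ⊂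
      Finset.univ.filter fun e => z e = 1 := by
    obtain ⟨e, he⟩ := List.exists_mem_of_ne_nil c.edges
      (by simpa [SimpleGraph.Walk.edges_eq_nil] using hc.not_nil)
    refine (Finset.ssubset_iff_of_subset hsub).2 ⟨e, by simp [hcz e he], ?_⟩
    simp [edgeSum_of_nodup hnd, he, hcz e he, CharTwo.add_self_eq_zero]
  have hmem := ih _ (hn ▸ Finset.card_lt_card hssub)
    ((cycleSpace G).add_mem hz (edgeSum_edges_mem_cycleSpace c))
    ((Finset.sum_le_sum_of_subset_of_nonneg hsub fun e _ _ => hw e).trans hzW) rfl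
  exact (S.add_mem_iff_left (hS a c (hcW.trans hzW))).1 hmem

end EdgeSum

/-- greedy computation of a shortest homology basis.  Let `G` be a finite
connected simple graph with nonnegative edge weights, `B` the span of the boundary edge
sets of a set `F` of triangles of `G`, and `g = dim (Z(G)/B)` (with `Z(G)/B` realized as
the image of the cycle space under the quotient map by `B`).  For each vertex `a` let
`T a` be a shortest-path tree rooted at `a`, let `γ a e` be the corresponding fundamental
cycles, and let `Pi` be the set of all these fundamental cycles.  If `L` lists the
elements of `Pi` without repetition in nondecreasing order of weight, then the greedy
selection from `L` (keeping a cycle iff its coset mod `B` is not in the span of the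
cosets of the previously kept ones) selects exactly `g` cycles, their cosets form a basis
of `Z(G)/B`, and their total weight is minimum among all families of `g` elements of
`Z(G)` whose cosets form a basis of `Z(G)/B`. -/
theorem greedy_shortest_homology_basis {V : Type*} [Fintype V] [DecidableEq V]
    (G : SimpleGraph V) [DecidableRel G.Adj] (hG : G.Connected)
    (w : Sym2 V → ℝ) (hw : ∀ e, 0 ≤ w e)
    (F : Set (V × V × V))
    (hF : ∀ t ∈ F, G.Adj t.1 t.2.1 ∧ G.Adj t.2.1 t.2.2 ∧ G.Adj t.1 t.2.2)
    (B : Submodule (ZMod 2) (Sym2 V → ZMod 2))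
    (hB : B = Submodule.span (ZMod 2)
      ((fun t : V × V × V => (fun f : Sym2 V =>
        if f = s(t.1, t.2.1) ∨ f = s(t.2.1, t.2.2) ∨ f = s(t.1, t.2.2)
        then (1 : ZMod 2) else 0)) '' F))
    (g : ℕ)
    (hg : Module.finrank (ZMod 2) ↥(Submodule.map B.mkQ (cycleSpace G)) = g)
    (T : V → SimpleGraph V)
    (hTsub : ∀ a, T a ≤ G) (hTtree : ∀ a, (T a).IsTree)
    (hshort : ∀ a u : V, ∀ p : (T a).Walk a u, p.IsPath →
      ∀ q : G.Walk a u, (p.edges.map w).sum ≤ (q.edges.map w).sum)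
    (γ : V → Sym2 V → (Sym2 V → ZMod 2))
    (hγ : ∀ (a u v : V), G.Adj u v → ¬ (T a).Adj u v →
      ∀ p : (T a).Walk u v, p.IsPath →
        γ a s(u, v) = fun f => if f = s(u, v) ∨ f ∈ p.edges then (1 : ZMod 2) else 0)
    (Pi : Set (Sym2 V → ZMod 2))
    (hPi : Pi = {c | ∃ a u v : V, G.Adj u v ∧ ¬ (T a).Adj u v ∧ c = γ a s(u, v)})
    (L : List (Sym2 V → ZMod 2))
    (hLmem : ∀ c, c ∈ L ↔ c ∈ Pi) (hLnd : L.Nodup)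
    (hLsorted : L.Pairwise (fun c c' => edgeWeight w c ≤ edgeWeight w c')) :
    (greedySelect B [] L).length = g ∧
    (LinearIndependent (ZMod 2)
        (fun i : Fin (greedySelect B [] L).length => B.mkQ ((greedySelect B [] L).get i)) ∧
      Submodule.span (ZMod 2) (B.mkQ '' {c | c ∈ greedySelect B [] L}) =
        Submodule.map B.mkQ (cycleSpace G)) ∧
    (∀ H : Fin g → (Sym2 V → ZMod 2), (∀ i, H i ∈ cycleSpace G) →
      LinearIndependent (ZMod 2) (fun i => B.mkQ (H i)) →
      Submodule.span (ZMod 2) (Set.range fun i => B.mkQ (H i)) =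
        Submodule.map B.mkQ (cycleSpace G) →
      ((greedySelect B [] L).map (edgeWeight w)).sum ≤ ∑ i, edgeWeight w (H i)) := by
  have hγ' : ∀ {a u v : V} (hG' : G.Adj u v) (hT : ¬ (T a).Adj u v) (p : (T a).Walk u v),
      p.IsPath → γ a s(u, v) = edgeSum (s(u, v) :: p.edges) := fun {a u v} hG' hT p hp => by
    have hnd : (s(u, v) :: p.edges).Nodup :=
      List.nodup_cons.2 ⟨fun h => hT (p.adj_of_mem_edges h), hp.isTrail.edges_nodup⟩
    rw [hγ a u v hG' hT p hp, edgeSum_of_nodup hnd]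
    simp only [List.mem_cons]
  have hPiZ : ∀ c ∈ Pi, c ∈ cycleSpace G := by
    rw [hPi]
    rintro _ ⟨a, u, v, huv, hT, rfl⟩
    obtain ⟨p, hp, -⟩ := (hTtree a).existsUnique_path u v
    rw [hγ' huv hT p hp]
    convert edgeSum_edges_mem_cycleSpace (.cons huv (p.mapLe (hTsub a)).reverse) using 1
    rw [SimpleGraph.Walk.edges_cons, SimpleGraph.Walk.edges_reverse,
      SimpleGraph.Walk.edges_mapLe_eq_edges, edgeSum_cons, edgeSum_cons, edgeSum_reverse]
  have hZ : ∀ z ∈ cycleSpace G,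
      z ∈ Submodule.span (ZMod 2) {c | c ∈ L ∧ edgeWeight w c ≤ edgeWeight w z} := by
    intro z hz
    refine mem_of_edgeWeight_le hw (fun a c hc => edgeSum_edges_mem_of_shortestPathTree hw
      (hTtree a) (hshort a) (fun u v huv hT p hp hW => Submodule.subset_span ?_) c hc) hz le_rfl
    rw [Set.mem_ofPred_eq, hLmem, hPi]
    exact ⟨⟨a, u, v, huv, hT, (hγ' huv hT p hp).symm⟩, hW⟩
  have hsub : ∀ c ∈ greedySelect B [] L, c ∈ L := fun c hc =>
    (greedySelect_sublist [] L).subset hc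
  have hmem : ∀ z ∈ cycleSpace G, B.mkQ z ∈ Submodule.span (ZMod 2)
      (B.mkQ '' {c | c ∈ greedySelect B [] L ∧ edgeWeight w c ≤ edgeWeight w z}) := by
    intro z hz
    have h := Submodule.mem_map_of_mem (f := B.mkQ) (hZ z hz)
    rw [Submodule.map_span] at h
    refine Submodule.span_le.2 ?_ h
    rintro _ ⟨c, ⟨hcL, hcz⟩, rfl⟩
    have hle : {x | x ∈ greedySelect B [] L ∧ edgeWeight w x ≤ edgeWeight w c} ⊆
        {x | x ∈ greedySelect B [] L ∧ edgeWeight w x ≤ edgeWeight w z} :=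
      fun x hx => ⟨hx.1, hx.2.trans hcz⟩
    exact Submodule.span_mono (Set.image_mono hle)
      (mkQ_mem_span_greedySelect (acc := []) hLsorted hcL)
  have hspan : Submodule.span (ZMod 2) (B.mkQ '' {c | c ∈ greedySelect B [] L}) =
      Submodule.map B.mkQ (cycleSpace G) := by
    apply le_antisymm
    · rw [Submodule.span_le]
      rintro _ ⟨c, hc, rfl⟩
      exact Submodule.mem_map_of_mem (hPiZ c ((hLmem c).1 (hsub c hc)))
    · rintro _ ⟨z, hz, rfl⟩
      have hle : {x | x ∈ greedySelect B [] L ∧ edgeWeight w x ≤ edgeWeight w z} ⊆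
          {x | x ∈ greedySelect B [] L} := fun x hx => hx.1
      exact Submodule.span_mono (Set.image_mono hle) (hmem z hz)
  have hli : LinearIndependent (ZMod 2)
      (fun i : Fin (greedySelect B [] L).length => B.mkQ ((greedySelect B [] L).get i)) := by
    have hon : LinearIndepOn (ZMod 2) B.mkQ {c | c ∈ greedySelect B [] L} :=
      linearIndepOn_greedySelect L (by simp)
    have hnd : (greedySelect B [] L).Nodup := hLnd.sublist (greedySelect_sublist [] L)
    exact hon.comp (fun i => ⟨(greedySelect B [] L).get i, List.get_mem _ _⟩)
      fun i j hij => hnd.injective_get (congrArg Subtype.val hij)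
  have hlen : (greedySelect B [] L).length = g := by
    have hrange : Set.range
        (fun i : Fin (greedySelect B [] L).length => B.mkQ ((greedySelect B [] L).get i)) =
        B.mkQ '' {c | c ∈ greedySelect B [] L} := by
      rw [← Set.range_list_get, ← Set.range_comp]; rfl
    have h := finrank_span_eq_card hli
    rw [hrange, hspan, hg, Fintype.card_fin] at h
    exact h.symm
  exact ⟨hlen, ⟨hli, hspan⟩, fun H hH hHli _ =>
    sum_map_le_sum_of_linearIndependent_mkQ
      (hLsorted.sublist (greedySelect_sublist [] L)) hlen H hHli fun i => hmem _ (hH i)⟩
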